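/- arXiv:1511.08057 — 2 statements merged into one kernel-verified Lean document; each statement's English description precedes it below -/
import Mathlib

section
/- Let 1 ≤ s ≤ N. A matrix M ∈ GL(2, Z/p^N Z) fixes T_{s,N} pointwise if and only if M = I + p^s·(0, a; 0, b) for some a, b ∈ Z/p^N Z (equivalently M₁₁ = 1, M₂₁ = 0, and both M₁₂ and M₂₂ − 1 lie in the ideal p^s(Z/p^N Z)). Consequently, the pointwise stabilizer of T_{s,N} in GL(2, Z/p^N Z) has exactly p^{2(N−s)} elements. -/
open Matrix

/-- The pointwise stabilizer of a set `T` of column vectors in `GL n A`: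
`Stab(T) = {M : M v = v for all v ∈ T}`. -/
def pointwiseStab {n A : Type*} [Fintype n] [DecidableEq n] [CommRing A]
    (T : Set (n → A)) : Subgroup (GL n A) where
  carrier := {M | ∀ v ∈ T, M.val.mulVec v = v}
  one_mem' v hv := by simp
  mul_mem' {M N} hM hN v hv := by
    rw [Units.val_mul, ← Matrix.mulVec_mulVec, hN v hv, hM v hv]
  inv_mem' {M} hM v hv := by
    conv_lhs => rw [← hM v hv]
    rw [Matrix.mulVec_mulVec, ← Units.val_mul, inv_mul_cancel, Units.val_one,
      Matrix.one_mulVec]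

/-- The subgroup `T_{s,N}` of `(ℤ/pᴺℤ)²` generated by `e₁ = (1,0)` and
`p^(N−s)·e₂ = (0, p^(N−s))`; it is isomorphic to `ℤ/pˢℤ ⊕ ℤ/pᴺℤ`. -/
def Tsub (p N s : ℕ) : AddSubgroup (Fin 2 → ZMod (p ^ N)) :=
  AddSubgroup.closure {![1, 0], ![0, (p : ZMod (p ^ N)) ^ (N - s)]}

lemma mul_ppow_eq_zero_iff (p N s : ℕ) (hp : p.Prime) (hsN : s ≤ N) (x : ZMod (p ^ N)) :
    x * (p : ZMod (p ^ N)) ^ (N - s) = 0 ↔ (p : ZMod (p ^ N)) ^ s ∣ x := by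
  have hpN : p ^ N = p ^ s * p ^ (N - s) := by rw [← pow_add]; congr 1; omega
  constructor
  · intro h
    obtain ⟨k, rfl⟩ := ZMod.intCast_surjective x
    have h2 : ((k * (p : ℤ) ^ (N - s) : ℤ) : ZMod (p ^ N)) = 0 := by push_cast; exact h
    rw [ZMod.intCast_zmod_eq_zero_iff_dvd, hpN] at h2
    push_cast at h2
    have h3 : (p : ℤ) ^ s ∣ k :=
      Int.dvd_of_mul_dvd_mul_right (pow_ne_zero _ (by exact_mod_cast hp.ne_zero)) h2
    obtain ⟨c, rfl⟩ := h3
    exact ⟨(c : ZMod (p ^ N)), by push_cast; rfl⟩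
  · rintro ⟨c, rfl⟩
    have : (p : ZMod (p ^ N)) ^ s * (p : ZMod (p ^ N)) ^ (N - s) = 0 := by
      have h := ZMod.natCast_self (p ^ N)
      rw [hpN] at h
      rw [← hpN] at h
      rw [← pow_add, Nat.add_sub_cancel' hsN]
      exact_mod_cast h
    linear_combination c * this

lemma fix_iff (p N s : ℕ) (hp : p.Prime) (hsN : s ≤ N) (M : GL (Fin 2) (ZMod (p ^ N))) :
    (∀ v ∈ Tsub p N s, M.val.mulVec v = v) ↔
        (M.val 0 0 = 1 ∧ M.val 1 0 = 0 ∧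
          M.val 0 1 ∈ Ideal.span {(p : ZMod (p ^ N)) ^ s} ∧
          M.val 1 1 - 1 ∈ Ideal.span {(p : ZMod (p ^ N)) ^ s}) := by
  have key : (∀ v ∈ Tsub p N s, M.val.mulVec v = v) ↔
      (M.val.mulVec ![1, 0] = ![1, 0] ∧ M.val.mulVec ![0, (p : ZMod (p ^ N)) ^ (N - s)] =
        ![0, (p : ZMod (p ^ N)) ^ (N - s)]) := by
    constructor
    · intro h
      exact ⟨h _ (AddSubgroup.subset_closure (by simp)),
        h _ (AddSubgroup.subset_closure (by simp))⟩
    · rintro ⟨h1, h2⟩ v hv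
      induction hv using AddSubgroup.closure_induction with
      | mem x hx =>
        rcases hx with rfl | rfl
        · exact h1
        · exact h2
      | zero => simp
      | add x y _ _ hx hy => rw [Matrix.mulVec_add, hx, hy]
      | neg x _ hx => rw [Matrix.mulVec_neg, hx]
  rw [key, Ideal.mem_span_singleton, Ideal.mem_span_singleton,
    ← mul_ppow_eq_zero_iff p N s hp hsN, ← mul_ppow_eq_zero_iff p N s hp hsN]
  simp only [funext_iff, Fin.forall_fin_two, Matrix.mulVec, dotProduct, Fin.sum_univ_two]
  simp [sub_mul, sub_eq_zero, and_assoc]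

lemma card_span (p N s : ℕ) (hp : p.Prime) (hsN : s ≤ N) :
    Nat.card (Ideal.span {(p : ZMod (p ^ N)) ^ s}) = p ^ (N - s) := by
  have h : (Ideal.span {(p : ZMod (p ^ N)) ^ s} : Set (ZMod (p ^ N))) =
      (AddSubgroup.zmultiples ((p ^ s : ℕ) : ZMod (p ^ N)) : Set (ZMod (p ^ N))) := by
    ext x
    simp only [SetLike.mem_coe, Ideal.mem_span_singleton', AddSubgroup.mem_zmultiples_iff]
    constructor
    · rintro ⟨a, rfl⟩
      obtain ⟨k, rfl⟩ := ZMod.intCast_surjective a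
      exact ⟨k, by simp⟩
    · rintro ⟨k, rfl⟩
      exact ⟨k, by simp⟩
  have h2 : Nat.card (Ideal.span {(p : ZMod (p ^ N)) ^ s}) =
      Nat.card (AddSubgroup.zmultiples ((p ^ s : ℕ) : ZMod (p ^ N))) :=
    Nat.card_congr (Equiv.setCongr h)
  rw [h2, Nat.card_zmultiples, ZMod.addOrderOf_coe _ (pow_ne_zero _ hp.ne_zero),
    Nat.gcd_eq_right (pow_dvd_pow p hsN), Nat.pow_div hsN hp.pos]

lemma card_stab (p N s : ℕ) (hp : p.Prime) (hs : 1 ≤ s) (hsN : s ≤ N) :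
    Nat.card (pointwiseStab (Tsub p N s : Set (Fin 2 → ZMod (p ^ N)))) =
      p ^ (2 * (N - s)) := by
  have hmem : ∀ M : GL (Fin 2) (ZMod (p ^ N)),
      M ∈ pointwiseStab (Tsub p N s : Set (Fin 2 → ZMod (p ^ N))) ↔ _ :=
    fun M => fix_iff p N s hp hsN M
  let f : pointwiseStab (Tsub p N s : Set (Fin 2 → ZMod (p ^ N))) →
      Ideal.span {(p : ZMod (p ^ N)) ^ s} × Ideal.span {(p : ZMod (p ^ N)) ^ s} :=
    fun M => (⟨M.1.val 0 1, ((hmem M.1).1 M.2).2.2.1⟩,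
      ⟨M.1.val 1 1 - 1, ((hmem M.1).1 M.2).2.2.2⟩)
  have hf : Function.Bijective f := by
    constructor
    · rintro ⟨M, hM⟩ ⟨M', hM'⟩ h
      obtain ⟨a1, a2, -, -⟩ := (hmem M).1 hM
      obtain ⟨b1, b2, -, -⟩ := (hmem M').1 hM'
      simp only [f, Prod.mk.injEq, Subtype.mk.injEq, sub_left_inj] at h
      apply Subtype.ext
      apply Units.ext
      ext i j
      fin_cases i <;> fin_cases j
      · exact a1.trans b1.symm
      · exact h.1
      · exact a2.trans b2.symm
      · exact h.2
    · rintro ⟨⟨x, hx⟩, ⟨y, hy⟩⟩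
      have hu : IsUnit (!![1, x; 0, 1 + y] : Matrix (Fin 2) (Fin 2) (ZMod (p ^ N))) := by
        rw [Matrix.isUnit_iff_isUnit_det, Matrix.det_fin_two_of]
        simp only [one_mul, mul_zero, sub_zero]
        apply IsNilpotent.isUnit_one_add
        obtain ⟨c, rfl⟩ := Ideal.mem_span_singleton.1 hy
        refine ⟨N, ?_⟩
        have h0 : (p : ZMod (p ^ N)) ^ N = 0 := by exact_mod_cast ZMod.natCast_self (p ^ N)
        have : ((p : ZMod (p ^ N)) ^ s) ^ N = 0 := by
          rw [← pow_mul, mul_comm, pow_mul, h0, zero_pow (by omega)]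
        rw [mul_pow, this, zero_mul]
      obtain ⟨M, hM⟩ := hu
      have hM' : M ∈ pointwiseStab (Tsub p N s : Set (Fin 2 → ZMod (p ^ N))) := by
        rw [hmem, hM]
        simpa using ⟨hx, hy⟩
      refine ⟨⟨M, hM'⟩, ?_⟩
      simp [f, hM]
  rw [Nat.card_congr (Equiv.ofBijective f hf), Nat.card_prod, card_span p N s hp hsN,
    ← pow_add, two_mul]

/-- For `1 ≤ s ≤ N`, a matrix `M ∈ GL(2, ℤ/pᴺℤ)` fixes `T_{s,N}` pointwise iff
`M = I + pˢ·(0, a; 0, b)` for some `a, b ∈ ℤ/pᴺℤ` (equivalently `M₁₁ = 1`, `M₂₁ = 0`, and both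
`M₁₂` and `M₂₂ − 1` lie in the ideal `pˢ(ℤ/pᴺℤ)`). Consequently, the pointwise stabilizer of
`T_{s,N}` in `GL(2, ℤ/pᴺℤ)` has exactly `p^(2(N−s))` elements. -/
theorem stabilizer_Tsub_characterization_and_card (p N s : ℕ) (hp : p.Prime)
    (hs : 1 ≤ s) (hsN : s ≤ N) :
    (∀ M : GL (Fin 2) (ZMod (p ^ N)),
      ((∀ v ∈ Tsub p N s, M.val.mulVec v = v) ↔
        ∃ a b : ZMod (p ^ N),
          M.val = 1 + (p : ZMod (p ^ N)) ^ s • !![0, a; 0, b]) ∧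
      ((∀ v ∈ Tsub p N s, M.val.mulVec v = v) ↔
        (M.val 0 0 = 1 ∧ M.val 1 0 = 0 ∧
          M.val 0 1 ∈ Ideal.span {(p : ZMod (p ^ N)) ^ s} ∧
          M.val 1 1 - 1 ∈ Ideal.span {(p : ZMod (p ^ N)) ^ s}))) ∧
    Nat.card (pointwiseStab (Tsub p N s : Set (Fin 2 → ZMod (p ^ N)))) =
      p ^ (2 * (N - s)) := by
  refine ⟨fun M => ⟨?_, fix_iff p N s hp hsN M⟩, card_stab p N s hp hs hsN⟩
  rw [fix_iff p N s hp hsN M, Ideal.mem_span_singleton, Ideal.mem_span_singleton]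
  constructor
  · rintro ⟨h1, h2, ⟨a, ha⟩, ⟨b, hb⟩⟩
    refine ⟨a, b, ?_⟩
    ext i j
    fin_cases i <;> fin_cases j
    · simpa using h1
    · simpa using ha
    · simpa using h2
    · simpa using sub_eq_iff_eq_add'.1 hb
  · rintro ⟨a, b, h⟩
    rw [h]
    simp
end

section
/- Let 0 ≤ s ≤ d ≤ N with d ≥ 1, and let G ≤ GL(2, Z/p^N Z) be the full preimage of its mod-p^d reduction G_d. Then π_d maps Stab_G(T_{s,N}) onto Stab_{G_d}(T_{s,d}), and |Stab_G(T_{s,N})| = |Stab_{G_d}(T_{s,d})| · p^{2(N−d)}, where T_{s,d} ⊆ (Z/p^d Z)² is the subgroup generated by (1,0) and (0, p^{d−s}). -/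
open Matrix

/-- The reduction homomorphism `π_d : GL(2, ℤ/pᴺℤ) → GL(2, ℤ/pᵈℤ)` induced by the canonical
ring homomorphism `ℤ/pᴺℤ → ℤ/pᵈℤ`, for `d ≤ N`. -/
noncomputable def redGL (p : ℕ) {d N : ℕ} (h : d ≤ N) :
    GL (Fin 2) (ZMod (p ^ N)) →* GL (Fin 2) (ZMod (p ^ d)) :=
  Matrix.GeneralLinearGroup.map (ZMod.castHom (pow_dvd_pow p h) (ZMod (p ^ d)))

lemma aux_mul_eq_zero (p : ℕ) (hp : p.Prime) {s N : ℕ} (h : s ≤ N) (x : ZMod (p ^ N)) :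
    x * (p : ZMod (p ^ N)) ^ (N - s) = 0 ↔
      ZMod.castHom (pow_dvd_pow p h) (ZMod (p ^ s)) x = 0 := by
  have : NeZero (p ^ N) := ⟨(pow_pos hp.pos N).ne'⟩
  obtain ⟨n, rfl⟩ := ZMod.natCast_zmod_surjective (n := p ^ N) x
  rw [map_natCast, ZMod.natCast_eq_zero_iff, ← Nat.cast_pow, ← Nat.cast_mul,
    ZMod.natCast_eq_zero_iff]
  have e : p ^ N = p ^ s * p ^ (N - s) := by rw [← pow_add]; congr 1; omega
  conv_lhs => rw [e]
  exact Nat.mul_dvd_mul_iff_right (pow_pos hp.pos _)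

lemma aux_mem_stab (p : ℕ) (hp : p.Prime) {s N : ℕ} (h : s ≤ N)
    (M : GL (Fin 2) (ZMod (p ^ N))) :
    M ∈ pointwiseStab (Tsub p N s : Set (Fin 2 → ZMod (p ^ N))) ↔
      M.val 0 0 = 1 ∧ M.val 1 0 = 0 ∧
      ZMod.castHom (pow_dvd_pow p h) (ZMod (p ^ s)) (M.val 0 1) = 0 ∧
      ZMod.castHom (pow_dvd_pow p h) (ZMod (p ^ s)) (M.val 1 1) = 1 := by
  have h1 : M ∈ pointwiseStab (Tsub p N s : Set (Fin 2 → ZMod (p ^ N))) ↔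
      M.val.mulVec ![1, 0] = ![1, 0] ∧
      M.val.mulVec ![0, (p : ZMod (p ^ N)) ^ (N - s)] = ![0, (p : ZMod (p ^ N)) ^ (N - s)] := by
    constructor
    · intro hM
      exact ⟨hM _ (AddSubgroup.subset_closure (by simp)),
        hM _ (AddSubgroup.subset_closure (by simp))⟩
    · rintro ⟨ha, hb⟩ v hv
      refine AddSubgroup.closure_induction (p := fun v _ => M.val.mulVec v = v)
        ?_ ?_ ?_ ?_ hv
      · rintro x (rfl | rfl)
        · exact ha
        · exact hb
      · exact Matrix.mulVec_zero _
      · intro x y _ _ hx hy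
        rw [Matrix.mulVec_add, hx, hy]
      · intro x _ hx
        rw [Matrix.mulVec_neg, hx]
  have h2 : ZMod.castHom (pow_dvd_pow p h) (ZMod (p ^ s)) (M.val 1 1) = 1 ↔
      ZMod.castHom (pow_dvd_pow p h) (ZMod (p ^ s)) (M.val 1 1 - 1) = 0 := by
    rw [map_sub, map_one, sub_eq_zero]
  rw [h1, h2, ← aux_mul_eq_zero p hp h, ← aux_mul_eq_zero p hp h, sub_mul, one_mul, sub_eq_zero]
  simp [funext_iff, Fin.forall_fin_two, and_assoc]

lemma aux_cast_cast (p : ℕ) {s d N : ℕ} (hsd : s ≤ d) (hdN : d ≤ N) (x : ZMod (p ^ N)) :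
    ZMod.castHom (pow_dvd_pow p hsd) (ZMod (p ^ s))
      (ZMod.castHom (pow_dvd_pow p hdN) (ZMod (p ^ d)) x) =
    ZMod.castHom (pow_dvd_pow p (hsd.trans hdN)) (ZMod (p ^ s)) x := by
  rw [← RingHom.comp_apply]
  congr 1
  exact Subsingleton.elim _ _

lemma aux_isUnit (p : ℕ) (hp : p.Prime) {d N : ℕ} (hd : 1 ≤ d) (hdN : d ≤ N) (x : ZMod (p ^ N))
    (hx : IsUnit (ZMod.castHom (pow_dvd_pow p hdN) (ZMod (p ^ d)) x)) : IsUnit x := by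
  have : NeZero (p ^ N) := ⟨(pow_pos hp.pos N).ne'⟩
  obtain ⟨n, rfl⟩ := ZMod.natCast_zmod_surjective (n := p ^ N) x
  rw [map_natCast, ZMod.isUnit_iff_coprime] at hx
  rw [ZMod.isUnit_iff_coprime]
  exact ((Nat.coprime_pow_right_iff (by omega) _ _).1 hx).pow_right _

lemma aux_red (p : ℕ) {d N : ℕ} (hdN : d ≤ N) (M : GL (Fin 2) (ZMod (p ^ N))) (i j : Fin 2) :
    (redGL p hdN M).val i j = ZMod.castHom (pow_dvd_pow p hdN) (ZMod (p ^ d)) (M.val i j) := rfl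

/-- Lifting the second column. -/
lemma aux_lift (p : ℕ) (hp : p.Prime) {d N : ℕ} (hd : 1 ≤ d) (hdN : d ≤ N)
    (M' : GL (Fin 2) (ZMod (p ^ d))) (h0 : M'.val 0 0 = 1) (h1 : M'.val 1 0 = 0)
    (b e : ZMod (p ^ N))
    (hb : ZMod.castHom (pow_dvd_pow p hdN) (ZMod (p ^ d)) b = M'.val 0 1)
    (he : ZMod.castHom (pow_dvd_pow p hdN) (ZMod (p ^ d)) e = M'.val 1 1) :
    ∃ M : GL (Fin 2) (ZMod (p ^ N)), M.val = !![1, b; 0, e] ∧ redGL p hdN M = M' := by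
  have hu : IsUnit (M'.val.det) := (Matrix.isUnit_iff_isUnit_det _).1 M'.isUnit
  rw [Matrix.det_fin_two, h0, h1, one_mul, mul_zero, sub_zero, ← he] at hu
  have hu' := aux_isUnit p hp hd hdN e hu
  have hm : IsUnit (!![1, b; 0, e] : Matrix (Fin 2) (Fin 2) (ZMod (p ^ N))) := by
    rw [Matrix.isUnit_iff_isUnit_det, Matrix.det_fin_two_of]
    simpa using hu'
  obtain ⟨M, hM⟩ := hm
  refine ⟨M, hM, ?_⟩
  apply Units.ext
  ext i j
  rw [aux_red, hM]
  fin_cases i <;> fin_cases j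
  · exact (map_one _).trans h0.symm
  · simpa using hb
  · exact (map_zero _).trans h1.symm
  · simpa using he

lemma aux_card_ker (p : ℕ) (hp : p.Prime) {d N : ℕ} (hdN : d ≤ N) :
    Nat.card {x : ZMod (p ^ N) // ZMod.castHom (pow_dvd_pow p hdN) (ZMod (p ^ d)) x = 0} =
      p ^ (N - d) := by
  set f := (ZMod.castHom (pow_dvd_pow p hdN) (ZMod (p ^ d))).toAddMonoidHom with hf
  have h1 := AddSubgroup.card_mul_index f.ker
  have hs : Function.Surjective f := ZMod.castHom_surjective (pow_dvd_pow p hdN)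
  rw [AddSubgroup.index_ker, AddMonoidHom.range_eq_top.2 hs, AddSubgroup.card_top, Nat.card_zmod,
    Nat.card_zmod] at h1
  have e : p ^ N = p ^ (N - d) * p ^ d := by rw [← pow_add]; congr 1; omega
  exact Nat.eq_of_mul_eq_mul_right (pow_pos hp.pos d) (h1.trans e)



/-- Let `0 ≤ s ≤ d ≤ N` with `d ≥ 1`, and let `G ≤ GL(2, ℤ/pᴺℤ)` be the full
preimage of its mod-`pᵈ` reduction `G_d`. Then `π_d` maps `Stab_G(T_{s,N})` onto
`Stab_{G_d}(T_{s,d})`, and `|Stab_G(T_{s,N})| = |Stab_{G_d}(T_{s,d})| · p^(2(N−d))`. -/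
theorem map_stabilizer_of_full_preimage (p : ℕ) (hp : p.Prime) (s d N : ℕ)
    (hd : 1 ≤ d) (hsd : s ≤ d) (hdN : d ≤ N)
    (G : Subgroup (GL (Fin 2) (ZMod (p ^ N))))
    (hG : G = Subgroup.comap (redGL p hdN) (Subgroup.map (redGL p hdN) G)) :
    Subgroup.map (redGL p hdN)
        (G ⊓ pointwiseStab (Tsub p N s : Set (Fin 2 → ZMod (p ^ N)))) =
      Subgroup.map (redGL p hdN) G ⊓
        pointwiseStab (Tsub p d s : Set (Fin 2 → ZMod (p ^ d))) ∧
    Nat.card (G ⊓ pointwiseStab (Tsub p N s : Set (Fin 2 → ZMod (p ^ N))) :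
        Subgroup (GL (Fin 2) (ZMod (p ^ N)))) =
      Nat.card (Subgroup.map (redGL p hdN) G ⊓
          pointwiseStab (Tsub p d s : Set (Fin 2 → ZMod (p ^ d))) :
        Subgroup (GL (Fin 2) (ZMod (p ^ d)))) * p ^ (2 * (N - d)) := by
  have hstab : ∀ M : GL (Fin 2) (ZMod (p ^ N)),
      M ∈ pointwiseStab (Tsub p N s : Set (Fin 2 → ZMod (p ^ N))) ↔
      M.val 0 0 = 1 ∧ M.val 1 0 = 0 ∧
        redGL p hdN M ∈ pointwiseStab (Tsub p d s : Set (Fin 2 → ZMod (p ^ d))) := by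
    intro M
    rw [aux_mem_stab p hp (hsd.trans hdN), aux_mem_stab p hp hsd]
    simp only [aux_red, aux_cast_cast p hsd hdN]
    constructor
    · rintro ⟨h0, h1, h2, h3⟩
      exact ⟨h0, h1, by rw [h0, map_one], by rw [h1, map_zero], h2, h3⟩
    · rintro ⟨h0, h1, _, _, h2, h3⟩
      exact ⟨h0, h1, h2, h3⟩
  have hGmem : ∀ M, M ∈ G ↔ redGL p hdN M ∈ Subgroup.map (redGL p hdN) G := by
    intro M
    conv_lhs => rw [hG]
    rfl
  have hmap : Subgroup.map (redGL p hdN)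
        (G ⊓ pointwiseStab (Tsub p N s : Set (Fin 2 → ZMod (p ^ N)))) =
      Subgroup.map (redGL p hdN) G ⊓
        pointwiseStab (Tsub p d s : Set (Fin 2 → ZMod (p ^ d))) := by
    apply le_antisymm
    · rintro _ ⟨M, ⟨hMG, hM⟩, rfl⟩
      exact ⟨(hGmem M).1 hMG, ((hstab M).1 hM).2.2⟩
    · rintro M' ⟨hMG, hM⟩
      have hM2 := (aux_mem_stab p hp hsd M').1 hM
      obtain ⟨b, hb⟩ := ZMod.castHom_surjective (pow_dvd_pow p hdN) (M'.val 0 1)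
      obtain ⟨e, he⟩ := ZMod.castHom_surjective (pow_dvd_pow p hdN) (M'.val 1 1)
      obtain ⟨M, hMv, hMr⟩ := aux_lift p hp hd hdN M' hM2.1 hM2.2.1 b e hb he
      refine ⟨M, ⟨(hGmem M).2 (hMr ▸ hMG), (hstab M).2 ⟨?_, ?_, hMr ▸ hM⟩⟩, hMr⟩
      · rw [hMv]; rfl
      · rw [hMv]; rfl
  refine ⟨hmap, ?_⟩
  rw [← hmap]
  set H := G ⊓ pointwiseStab (Tsub p N s : Set (Fin 2 → ZMod (p ^ N))) with hH
  have h1 := Subgroup.card_mul_index ((redGL p hdN).subgroupMap H).ker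
  rw [Subgroup.index_ker, MonoidHom.range_eq_top.2 ((redGL p hdN).subgroupMap_surjective H),
    Subgroup.card_top] at h1
  rw [← h1, mul_comm]
  congr 1
  let K := {x : ZMod (p ^ N) // ZMod.castHom (pow_dvd_pow p hdN) (ZMod (p ^ d)) x = 0}
  have hker : ∀ M : ((redGL p hdN).subgroupMap H).ker, redGL p hdN M.1.1 = 1 := by
    intro M
    exact congrArg Subtype.val M.2
  let φ : ((redGL p hdN).subgroupMap H).ker → K × K := fun M =>
    (⟨M.1.1.val 0 1, by rw [← aux_red p hdN, hker M]; rfl⟩,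
     ⟨M.1.1.val 1 1 - 1, by rw [map_sub, map_one, ← aux_red p hdN, hker M]; simp⟩)
  have hφ : Function.Bijective φ := by
    constructor
    · intro A B hAB
      have e1 : A.1.1.val 0 1 = B.1.1.val 0 1 := congrArg (fun z : K × K => z.1.1) hAB
      have e2 : A.1.1.val 1 1 - 1 = B.1.1.val 1 1 - 1 := congrArg (fun z : K × K => z.2.1) hAB
      have hA := (hstab _).1 A.1.2.2
      have hB := (hstab _).1 B.1.2.2
      apply Subtype.ext
      apply Subtype.ext
      apply Units.ext
      ext i j
      fin_cases i <;> fin_cases j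
      · exact hA.1.trans hB.1.symm
      · exact e1
      · exact hA.2.1.trans hB.2.1.symm
      · exact sub_left_injective e2
    · rintro ⟨⟨b, hb⟩, ⟨c, hc⟩⟩
      obtain ⟨M, hMv, hMr⟩ := aux_lift p hp hd hdN 1 rfl rfl b (c + 1)
        (by rw [hb]; rfl) (by rw [map_add, hc, map_one, zero_add]; rfl)
      have hMH : M ∈ H := by
        refine ⟨(hGmem M).2 (hMr ▸ one_mem _), (hstab M).2 ⟨?_, ?_, hMr ▸ one_mem _⟩⟩
        · rw [hMv]; rfl
        · rw [hMv]; rfl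
      refine ⟨⟨⟨M, hMH⟩, Subtype.ext hMr⟩, ?_⟩
      apply Prod.ext
      · apply Subtype.ext
        change M.val 0 1 = b
        rw [hMv]; rfl
      · apply Subtype.ext
        change M.val 1 1 - 1 = c
        rw [hMv]
        simp
  rw [Nat.card_congr (Equiv.ofBijective φ hφ), Nat.card_prod, aux_card_ker p hp hdN, two_mul,
    pow_add]
end
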